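/- arXiv:2310.00531 — 2 statements merged into one kernel-verified Lean document; each statement's English description precedes it below -/
import Mathlib

section
/- Let X be a topological space, let Y ⊆ ℝⁿ be a convex set satisfying property (A), and let F be a correspondence from X to Y whose upper sections F(x) are separately convex for every x ∈ X. Then the following are equivalent: (i) F has open upper sections; (ii) F has linearly open upper sections; (iii) F has separately open upper sections. -/
open Set

/-- `L` is a straight line in `Y`: the intersection of `Y` with a
one-dimensional affine subspace of `ℝⁿ`. -/
def IsLineIn {n : ℕ} (Y L : Set (Fin n → ℝ)) : Prop :=
  ∃ (p v : Fin n → ℝ), v ≠ 0 ∧ L = Y ∩ {z | ∃ t : ℝ, z = p + t • v}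

/-- `L` is a straight line in `Y` parallel to the `i`-th coordinate axis. -/
def IsAxisLineIn {n : ℕ} (Y L : Set (Fin n → ℝ)) : Prop :=
  ∃ (p : Fin n → ℝ) (i : Fin n), L = Y ∩ {z | ∃ t : ℝ, z = p + t • (Pi.single i 1 : Fin n → ℝ)}

/-- `A` is separately convex in `Y`. -/
def SepConvexIn {n : ℕ} (Y A : Set (Fin n → ℝ)) : Prop :=
  ∀ L, IsAxisLineIn Y L → Convex ℝ (A ∩ L)

/-- Property (A): `Y` is open or a product of subsets of `ℝ`. -/
def PropertyA {n : ℕ} (Y : Set (Fin n → ℝ)) : Prop :=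
  IsOpen Y ∨ ∃ Yi : Fin n → Set ℝ, Y = Set.univ.pi Yi

open Topology

/-- A relative neighbourhood of a point of an order-connected set contains the endpoints of an
interval that is itself a relative neighbourhood of the point. -/
theorem exists_endpoints_of_eventually {C : Set ℝ} (hC : C.OrdConnected) (c : C) {p : C → Prop}
    (hp : ∀ᶠ t in 𝓝 c, p t) :
    ∃ a b : C, p a ∧ p b ∧ Icc (a : ℝ) b ∈ 𝓝[C] (c : ℝ) := by
  have := hC
  obtain ⟨a, b, hc, hn, hs⟩ := exists_Icc_mem_subset_of_mem_nhds hp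
  have hab : a ≤ b := hc.1.trans hc.2
  refine ⟨a, b, hs (left_mem_Icc.2 hab), hs (right_mem_Icc.2 hab), ?_⟩
  exact preimage_coe_mem_nhds_subtype.1 hn

/-- A point and any of its one-coordinate modifications lie on a common axis-parallel line. -/
theorem update_mem_axis_line {n : ℕ} (w : Fin n → ℝ) (j : Fin n) (t : ℝ) :
    Function.update w j t ∈ {z | ∃ s : ℝ, z = w + s • (Pi.single j 1 : Fin n → ℝ)} := by
  refine ⟨t - w j, ?_⟩
  ext i
  by_cases h : i = j
  · subst h; simp
  · simp [h]

theorem eventually_update_mem {n : ℕ} {Y A : Set (Fin n → ℝ)}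
    (hA : ∀ L, IsAxisLineIn Y L → IsOpen (Subtype.val ⁻¹' A : Set L))
    {C : Fin n → Set ℝ} (hCY : univ.pi C ⊆ Y) {w : Fin n → ℝ} (hwC : w ∈ univ.pi C)
    (hwA : w ∈ A) {j : Fin n} (c : C j) (hc : (c : ℝ) = w j) :
    ∀ᶠ t : C j in 𝓝 c, Function.update w j (t : ℝ) ∈ A := by
  have hmem : ∀ t : C j, Function.update w j (t : ℝ) ∈
      Y ∩ {z | ∃ s : ℝ, z = w + s • (Pi.single j 1 : Fin n → ℝ)} := fun t =>
    ⟨hCY (update_mem_pi_iff_of_mem hwC |>.2 fun _ => t.2), update_mem_axis_line w j t⟩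
  have hg : Continuous fun t : C j => (⟨_, hmem t⟩ :
      ↥(Y ∩ {z | ∃ s : ℝ, z = w + s • (Pi.single j 1 : Fin n → ℝ)})) :=
    ((continuous_const (y := w)).update j continuous_subtype_val).subtype_mk hmem
  refine ((hA _ ⟨w, j, rfl⟩).preimage hg).mem_nhds ?_
  simpa [hc] using hwA

/-- A separately convex set containing the vertices of a box in `Y` contains the box. -/
theorem SepConvexIn.pi_Icc_subset {n : ℕ} {Y A : Set (Fin n → ℝ)} (hA : SepConvexIn Y A)
    (hAY : A ⊆ Y) {a b : Fin n → ℝ}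
    (hv : ∀ z : Fin n → ℝ, (∀ i, z i = a i ∨ z i = b i) → z ∈ A) :
    univ.pi (fun i => Icc (a i) (b i)) ⊆ A := by
  have key : ∀ T : Finset (Fin n), ∀ z : Fin n → ℝ, (∀ i ∈ T, z i ∈ Icc (a i) (b i)) →
      (∀ i ∉ T, z i = a i ∨ z i = b i) → z ∈ A := by
    intro T
    induction T using Finset.induction_on with
    | empty => exact fun z _ hz => hv z fun i => hz i (Finset.notMem_empty i)
    | insert j T hj ih =>
      intro z hz hz'
      have hend : ∀ t, t = a j ∨ t = b j → Function.update z j t ∈ A := by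
        intro t ht
        refine ih _ (fun i hi => ?_) fun i hi => ?_
        · have hij : i ≠ j := fun h => hj (h ▸ hi)
          simpa [hij] using hz i (Finset.mem_insert_of_mem hi)
        · by_cases hij : i = j
          · subst hij; simpa using ht
          · simpa [hij] using hz' i (by simp [hij, hi])
      have hconv := hA _ ⟨z, j, rfl⟩
      have ha := hend (a j) (Or.inl rfl)
      have hb := hend (b j) (Or.inr rfl)
      have hzj := hz j (Finset.mem_insert_self j T)
      rw [← segment_eq_Icc (hzj.1.trans hzj.2)] at hzj
      obtain ⟨r, s, hr, hs, hrs, hz_eq⟩ := hzj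
      have hcomb := (hconv ⟨ha, hAY ha, update_mem_axis_line z j _⟩
        ⟨hb, hAY hb, update_mem_axis_line z j _⟩ hr hs hrs).1
      convert hcomb using 1
      ext i
      by_cases hij : i = j
      · subst hij; simpa using hz_eq.symm
      · simp [hij, ← add_mul, hrs]
  exact fun z hz => key Finset.univ z (fun i _ => hz i (mem_univ i)) (by simp)

theorem mem_nhdsWithin_pi_of_separately {n : ℕ} {Y A : Set (Fin n → ℝ)} (hAY : A ⊆ Y)
    (hconv : SepConvexIn Y A)
    (hopen : ∀ L, IsAxisLineIn Y L → IsOpen (Subtype.val ⁻¹' A : Set L))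
    {C : Fin n → Set ℝ} (hC : ∀ i, (C i).OrdConnected) (hCY : univ.pi C ⊆ Y)
    {y : Fin n → ℝ} (hyC : y ∈ univ.pi C) (hyA : y ∈ A) :
    A ∈ 𝓝[univ.pi C] y := by
  have key : ∀ S : Finset (Fin n), ∃ a b : Fin n → ℝ,
      (∀ i ∈ S, a i ∈ C i ∧ b i ∈ C i ∧ Icc (a i) (b i) ∈ 𝓝[C i] y i) ∧
      ∀ z : Fin n → ℝ, (∀ i ∈ S, z i = a i ∨ z i = b i) → (∀ i ∉ S, z i = y i) → z ∈ A := by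
    intro S
    induction S using Finset.induction_on with
    | empty =>
      refine ⟨y, y, by simp, fun z _ hz => ?_⟩
      rwa [show z = y from funext fun i => hz i (Finset.notMem_empty i)]
    | insert j S hj ih =>
      obtain ⟨a, b, hab, hv⟩ := ih
      set V : Set (Fin n → ℝ) :=
        {z | (∀ i ∈ S, z i = a i ∨ z i = b i) ∧ ∀ i ∉ S, z i = y i}
      have hfin : V.Finite := by
        refine (Set.Finite.pi' fun i => Set.toFinite ({a i, b i, y i} : Set ℝ)).subset ?_
        intro z hz i
        by_cases hi : i ∈ S
        · rcases hz.1 i hi with h | h <;> simp [h]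
        · simp [hz.2 i hi]
      have hVC : V ⊆ univ.pi C := by
        intro z hz i _
        by_cases hi : i ∈ S
        · rcases hz.1 i hi with h | h <;> rw [h]
          exacts [(hab i hi).1, (hab i hi).2.1]
        · rw [hz.2 i hi]; exact hyC i (mem_univ i)
      have hev : ∀ᶠ t : C j in 𝓝 ⟨y j, hyC j (mem_univ j)⟩,
          ∀ w ∈ V, Function.update w j (t : ℝ) ∈ A :=
        (Filter.eventually_all_finite hfin).2 fun w hw =>
          eventually_update_mem hopen hCY (hVC hw) (hv w hw.1 hw.2) _ (hw.2 j hj).symm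
      obtain ⟨α, β, hα, hβ, hn⟩ := exists_endpoints_of_eventually (hC j) _ hev
      refine ⟨Function.update a j α, Function.update b j β, fun i hi => ?_, fun z hz hz' => ?_⟩
      · by_cases hij : i = j
        · subst hij; simpa using hn
        · simpa [hij] using hab i (Finset.mem_of_mem_insert_of_ne hi hij)
      · have hw : Function.update z j (y j) ∈ V := by
          refine ⟨fun i hi => ?_, fun i hi => ?_⟩
          · have hij : i ≠ j := fun h => hj (h ▸ hi)
            simpa [hij] using hz i (Finset.mem_insert_of_mem hi)
          · by_cases hij : i = j
            · subst hij; simp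
            · simpa [hij] using hz' i (by simp [hij, hi])
        have hzj := hz j (Finset.mem_insert_self j S)
        simp only [Function.update_self] at hzj
        rcases hzj with h | h
        · simpa [← h] using hα _ hw
        · simpa [← h] using hβ _ hw
  obtain ⟨a, b, hab, hv⟩ := key Finset.univ
  refine Filter.mem_of_superset ?_
    (hconv.pi_Icc_subset hAY fun z hz => hv z (fun i _ => hz i) (by simp))
  rw [nhdsWithin_pi_univ_eq, pi_def, Filter.biInter_mem finite_univ]
  exact fun i _ => Filter.mem_iInf_of_mem i
    (Filter.preimage_mem_comap (hab i (Finset.mem_univ i)).2.2)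

/-- Every point of a convex set with property (A) has a relative neighbourhood that is a product
of order-connected sets. -/
theorem PropertyA.exists_pi_mem_nhdsWithin {n : ℕ} {Y : Set (Fin n → ℝ)} (hYA : PropertyA Y)
    (hY : Convex ℝ Y) {y : Fin n → ℝ} (hy : y ∈ Y) :
    ∃ C : Fin n → Set ℝ, (∀ i, (C i).OrdConnected) ∧ univ.pi C ⊆ Y ∧ y ∈ univ.pi C ∧
      univ.pi C ∈ 𝓝[Y] y := by
  rcases hYA with hO | ⟨Z, rfl⟩
  · obtain ⟨ε, hε, hball⟩ := Metric.isOpen_iff.1 hO y hy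
    rw [ball_pi y hε] at hball
    refine ⟨fun i => Metric.ball (y i) ε, fun i => (convex_ball _ _).ordConnected, hball,
      fun i _ => Metric.mem_ball_self hε, mem_nhdsWithin_of_mem_nhds ?_⟩
    rw [← ball_pi y hε]
    exact Metric.ball_mem_nhds y hε
  · have hsub : univ.pi Z ⊆ univ.pi fun i => Function.eval i '' univ.pi Z :=
      fun z hz i _ => ⟨z, hz, rfl⟩
    refine ⟨fun i => Function.eval i '' univ.pi Z, fun i => ?_, fun z hz i _ => ?_, hsub hy,
      Filter.mem_of_superset self_mem_nhdsWithin hsub⟩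
    · exact (hY.linear_image (LinearMap.proj i : (Fin n → ℝ) →ₗ[ℝ] ℝ)).ordConnected
    · obtain ⟨w, hw, hwz⟩ := hz i (mem_univ i)
      exact hwz ▸ hw i (mem_univ i)

/-- A relatively open subset of `Y` is relatively open in every subset of `Y`. -/
theorem isOpen_preimage_val_of_subset {α : Type*} [TopologicalSpace α] {Y L A : Set α}
    (hL : L ⊆ Y) (hA : IsOpen (Subtype.val ⁻¹' A : Set Y)) :
    IsOpen (Subtype.val ⁻¹' A : Set L) :=
  hA.preimage (continuous_inclusion hL)

/-- Proposition (a): for a correspondence `F` from a topological space `X` into a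
convex set `Y ⊆ ℝⁿ` with property (A) whose upper sections are separately convex,
the following are equivalent: open upper sections, linearly open upper sections,
separately open upper sections. -/
theorem proposition_a {X : Type*} [TopologicalSpace X] {n : ℕ} {Y : Set (Fin n → ℝ)}
    (hYconv : Convex ℝ Y) (hYA : PropertyA Y)
    (F : X → Set (Fin n → ℝ)) (hFY : ∀ x, F x ⊆ Y)
    (hFsc : ∀ x, SepConvexIn Y (F x)) :
    ((∀ x, IsOpen (Subtype.val ⁻¹' F x : Set Y)) ↔
      (∀ x, ∀ L, IsLineIn Y L → IsOpen (Subtype.val ⁻¹' F x : Set L))) ∧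
    ((∀ x, ∀ L, IsLineIn Y L → IsOpen (Subtype.val ⁻¹' F x : Set L)) ↔
      (∀ x, ∀ L, IsAxisLineIn Y L → IsOpen (Subtype.val ⁻¹' F x : Set L))) := by
  have hopen_lin (x : X) (hx : IsOpen (Subtype.val ⁻¹' F x : Set Y)) :
      ∀ L, IsLineIn Y L → IsOpen (Subtype.val ⁻¹' F x : Set L) := by
    rintro L ⟨p, v, -, rfl⟩
    exact isOpen_preimage_val_of_subset inter_subset_left hx
  have hlin_sep (x : X) (hx : ∀ L, IsLineIn Y L → IsOpen (Subtype.val ⁻¹' F x : Set L)) :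
      ∀ L, IsAxisLineIn Y L → IsOpen (Subtype.val ⁻¹' F x : Set L) := by
    rintro L ⟨p, i, rfl⟩
    exact hx _ ⟨p, Pi.single i 1, by simp, rfl⟩
  have hsep_open (x : X) (hx : ∀ L, IsAxisLineIn Y L → IsOpen (Subtype.val ⁻¹' F x : Set L)) :
      IsOpen (Subtype.val ⁻¹' F x : Set Y) := by
    refine isOpen_iff_mem_nhds.2 fun y hy => preimage_coe_mem_nhds_subtype.2 ?_
    obtain ⟨C, hC, hCY, hyC, hn⟩ := hYA.exists_pi_mem_nhdsWithin hYconv y.2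
    exact nhdsWithin_le_of_mem hn
      (mem_nhdsWithin_pi_of_separately (hFY x) (hFsc x) hx hC hCY hyC hy)
  exact ⟨⟨fun h x => hopen_lin x (h x), fun h x => hsep_open x (hlin_sep x (h x))⟩,
    ⟨fun h x => hlin_sep x (h x), fun h x => hopen_lin x (hsep_open x (h x))⟩⟩
end

section
/- Let X = {x ∈ ℝ² : x₁ ≥ 0, x₂ ≥ 0, x₁² + x₂² ≤ 1} with the subspace topology from ℝ², and let f : [0,1] → ℝ² be given by f(t) = (sin(πt/2), cos(πt/2)). Define a correspondence F from X to X by F(x) = X if x₁ = 1, and F(x) = X \ {f(x₁)} if x₁ < 1. Then X is convex; F(x) is convex and open in X for every x ∈ X; F⁻¹(y) = {x ∈ X : y ∈ F(x)} is open in X for every y ∈ X; but the graph gr F = {(x,y) ∈ X × X : y ∈ F(x)} is not open in X × X. (In particular, a convex-valued correspondence with open upper and lower sections on an arbitrary convex subset of ℝⁿ need not have an open graph.) -/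
open Set

/-- The quarter disc `X = {x ∈ ℝ²₊ : x₁² + x₂² ≤ 1}`. -/
def Xqd : Set (Fin 2 → ℝ) :=
  {x | 0 ≤ x 0 ∧ 0 ≤ x 1 ∧ (x 0) ^ 2 + (x 1) ^ 2 ≤ 1}

/-- The parametrization `f(t) = (sin (πt/2), cos (πt/2))` of the arc. -/
noncomputable def fArc (t : ℝ) : Fin 2 → ℝ :=
  ![Real.sin (Real.pi * t / 2), Real.cos (Real.pi * t / 2)]

/-- The correspondence `F x = X` if `x₁ = 1` and `F x = X \ {f x₁}` otherwise. -/
noncomputable def Fqd : (Fin 2 → ℝ) → Set (Fin 2 → ℝ) := fun x =>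
  if x 0 = 1 then Xqd else Xqd \ {fArc (x 0)}

theorem convex_Xqd : Convex ℝ Xqd := by
  rintro y ⟨hy0, hy1, hy⟩ z ⟨hz0, hz1, hz⟩ a b ha hb hab
  refine ⟨?_, ?_, ?_⟩
  · simp only [Pi.add_apply, Pi.smul_apply, smul_eq_mul]
    positivity
  · simp only [Pi.add_apply, Pi.smul_apply, smul_eq_mul]
    positivity
  · simp only [Pi.add_apply, Pi.smul_apply, smul_eq_mul]
    obtain rfl : b = 1 - a := by linarith
    nlinarith [mul_le_mul_of_nonneg_left hy ha, mul_le_mul_of_nonneg_left hz hb,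
      mul_nonneg (mul_nonneg ha hb) (add_nonneg (sq_nonneg (y 0 - z 0)) (sq_nonneg (y 1 - z 1)))]

theorem fArc_sq_add_sq (t : ℝ) : fArc t 0 ^ 2 + fArc t 1 ^ 2 = 1 := by
  simp [fArc]

/-- A point of the unit disc whose inner product with a unit vector is at least `1` is that
vector. -/
theorem eq_of_one_le_dot {p y : Fin 2 → ℝ} (hp : p 0 ^ 2 + p 1 ^ 2 = 1)
    (hy : y 0 ^ 2 + y 1 ^ 2 ≤ 1) (h : 1 ≤ p 0 * y 0 + p 1 * y 1) : y = p := by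
  have h0 : (y 0 - p 0) ^ 2 = 0 := by
    nlinarith [sq_nonneg (y 0 - p 0), sq_nonneg (y 1 - p 1)]
  have h1 : (y 1 - p 1) ^ 2 = 0 := by
    nlinarith [sq_nonneg (y 0 - p 0), sq_nonneg (y 1 - p 1)]
  ext i
  fin_cases i
  · exact sub_eq_zero.1 (pow_eq_zero_iff two_ne_zero |>.1 h0)
  · exact sub_eq_zero.1 (pow_eq_zero_iff two_ne_zero |>.1 h1)

theorem convex_Xqd_diff_singleton {p : Fin 2 → ℝ} (hp : p 0 ^ 2 + p 1 ^ 2 = 1) :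
    Convex ℝ (Xqd \ {p}) := by
  have dot_lt : ∀ y ∈ Xqd \ {p}, p 0 * y 0 + p 1 * y 1 < 1 := fun y hy =>
    lt_of_not_ge fun h => hy.2 (eq_of_one_le_dot hp hy.1.2.2 h)
  intro y hy z hz a b ha hb hab
  refine ⟨convex_Xqd hy.1 hz.1 ha hb hab, fun h => ?_⟩
  have hmem := (convex_Iio (𝕜 := ℝ) (1 : ℝ)) (dot_lt y hy) (dot_lt z hz) ha hb hab
  have h0 : a * y 0 + b * z 0 = p 0 := congrFun h 0
  have h1 : a * y 1 + b * z 1 = p 1 := congrFun h 1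
  simp only [mem_Iio, smul_eq_mul] at hmem
  have : a * (p 0 * y 0 + p 1 * y 1) + b * (p 0 * z 0 + p 1 * z 1) = 1 := by
    rw [← hp]
    linear_combination p 0 * h0 + p 1 * h1
  linarith

theorem fArc_mem_Xqd {t : ℝ} (ht : t ∈ Icc (0 : ℝ) 1) : fArc t ∈ Xqd := by
  have hpi := Real.pi_pos
  refine ⟨?_, ?_, (fArc_sq_add_sq t).le⟩
  · exact Real.sin_nonneg_of_nonneg_of_le_pi (by have := ht.1; positivity) (by nlinarith [ht.2])
  · exact Real.cos_nonneg_of_neg_pi_div_two_le_of_le (by nlinarith [ht.1]) (by nlinarith [ht.2])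

theorem injOn_fArc : InjOn fArc (Icc 0 1) := by
  intro s hs t ht h
  have hpi := Real.pi_pos
  have hsin : Real.sin (Real.pi * s / 2) = Real.sin (Real.pi * t / 2) := congrFun h 0
  have := Real.injOn_sin ⟨by nlinarith [hs.1], by nlinarith [hs.2]⟩
    ⟨by nlinarith [ht.1], by nlinarith [ht.2]⟩ hsin
  exact mul_left_cancel₀ hpi.ne' (by linarith)

theorem continuous_fArc : Continuous fArc := by
  refine continuous_pi fun i => ?_
  fin_cases i
  · change Continuous fun t : ℝ => Real.sin (Real.pi * t / 2)
    fun_prop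
  · change Continuous fun t : ℝ => Real.cos (Real.pi * t / 2)
    fun_prop

theorem apply_zero_mem_Icc {x : Fin 2 → ℝ} (hx : x ∈ Xqd) : x 0 ∈ Icc (0 : ℝ) 1 :=
  ⟨hx.1, by nlinarith [hx.2.2, sq_nonneg (x 1)]⟩

theorem mem_Fqd_iff {x y : Fin 2 → ℝ} (hy : y ∈ Xqd) :
    y ∈ Fqd x ↔ (y = fArc (x 0) → x 0 = 1) := by
  unfold Fqd
  split_ifs with h <;> simp [hy, h]

theorem convex_Fqd (x : Fin 2 → ℝ) : Convex ℝ (Fqd x) := by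
  unfold Fqd
  split_ifs
  · exact convex_Xqd
  · exact convex_Xqd_diff_singleton (fArc_sq_add_sq _)

theorem isOpen_upper_section (x : Fin 2 → ℝ) :
    IsOpen (Subtype.val ⁻¹' Fqd x : Set Xqd) := by
  unfold Fqd
  split_ifs
  · simp
  · have : (Subtype.val ⁻¹' (Xqd \ {fArc (x 0)}) : Set Xqd) =
        Subtype.val ⁻¹' {fArc (x 0)}ᶜ := by
      ext y
      simp
    rw [this]
    exact isOpen_compl_singleton.preimage continuous_subtype_val

theorem isOpen_lower_section {y : Fin 2 → ℝ} (hy : y ∈ Xqd) :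
    IsOpen (Subtype.val ⁻¹' {x | y ∈ Fqd x} : Set Xqd) := by
  by_cases h : ∃ t ∈ Icc (0 : ℝ) 1, t ≠ 1 ∧ y = fArc t
  · obtain ⟨t, ht, ht1, rfl⟩ := h
    have : (Subtype.val ⁻¹' {x | fArc t ∈ Fqd x} : Set Xqd) =
        (fun x : Xqd => (x : Fin 2 → ℝ) 0) ⁻¹' {t}ᶜ := by
      ext x
      simp only [mem_preimage, mem_ofPred_eq, mem_Fqd_iff hy, mem_compl_iff, mem_singleton_iff]
      constructor
      · intro hx hxt
        exact ht1 (hxt ▸ hx (by rw [hxt]))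
      · intro hx heq
        exact absurd (injOn_fArc ht (apply_zero_mem_Icc x.2) heq).symm hx
    rw [this]
    exact isOpen_compl_singleton.preimage
      ((continuous_apply 0).comp continuous_subtype_val)
  · convert isOpen_univ
    refine eq_univ_of_forall fun x => (mem_Fqd_iff hy).2 fun heq => ?_
    by_contra hx
    exact h ⟨_, apply_zero_mem_Icc x.2, hx, heq⟩

theorem not_isOpen_graph :
    ¬ IsOpen {p : Xqd × Xqd | (p.2 : Fin 2 → ℝ) ∈ Fqd (p.1 : Fin 2 → ℝ)} := by
  intro hopen
  have hbase : ∀ t : unitInterval, ![(t : ℝ), 0] ∈ Xqd := fun t =>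
    ⟨t.2.1, le_rfl, by simpa [abs_of_nonneg t.2.1] using t.2.2⟩
  let g : unitInterval → Xqd × Xqd := fun t =>
    (⟨![(t : ℝ), 0], hbase t⟩, ⟨fArc t, fArc_mem_Xqd t.2⟩)
  have hg : Continuous g := by
    refine Continuous.prodMk (Continuous.subtype_mk ?_ _)
      ((continuous_fArc.comp continuous_subtype_val).subtype_mk _)
    refine continuous_pi fun i => ?_
    fin_cases i
    · exact continuous_subtype_val
    · exact continuous_const
  have hpre : g ⁻¹' {p | (p.2 : Fin 2 → ℝ) ∈ Fqd (p.1 : Fin 2 → ℝ)} = {1} := by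
    ext t
    simp [g, mem_Fqd_iff (fArc_mem_Xqd t.2)]
  have hclopen : IsClopen ({1} : Set unitInterval) :=
    ⟨isClosed_singleton, hpre ▸ hopen.preimage hg⟩
  have huniv := hclopen.eq_univ (singleton_nonempty _)
  have : (0 : unitInterval) ∈ ({1} : Set unitInterval) := huniv ▸ mem_univ _
  exact zero_ne_one (mem_singleton_iff.1 this)

/-- Example (Yamazaki): `X` is convex; `F` is convex-valued with open upper and
lower sections in `X`, yet the graph of `F` is not open in `X × X`. -/
theorem example_yamazaki :
    Convex ℝ Xqd ∧
    (∀ x ∈ Xqd, Convex ℝ (Fqd x) ∧ IsOpen (Subtype.val ⁻¹' Fqd x : Set Xqd)) ∧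
    (∀ y ∈ Xqd, IsOpen (Subtype.val ⁻¹' {x | y ∈ Fqd x} : Set Xqd)) ∧
    ¬ IsOpen {p : Xqd × Xqd | (p.2 : Fin 2 → ℝ) ∈ Fqd (p.1 : Fin 2 → ℝ)} := by
  exact ⟨convex_Xqd, fun x _ => ⟨convex_Fqd x, isOpen_upper_section x⟩,
    fun _ hy => isOpen_lower_section hy, not_isOpen_graph⟩
end
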